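/- arXiv:2402.14369 — 4 statements merged into one kernel-verified Lean document; each statement's English description precedes it below -/
import Mathlib

section
/- Suppose there exist constants C_V, C_U, C_s > 0 such that ‖V^k‖_F² ≤ C_V, ‖U^k‖_F² ≤ C_U and ‖s^k‖₂² ≤ C_s for all k ≥ 0, and suppose ρ ≥ max(24 λ_ex² C_V C_s / λ̲_V, 1/2 + √(1/4 + 6 λ_ex² C_V²)) and 0 < γ ≤ 1/(√m((1+α₀)C_V + λ̄_U) + 1). Then the sequence of augmented Lagrangian values L_ρ(V^k, U^k, s^k, w^k) converges to some real number, and the residual norms ‖V^{k+1} − V^k‖_F, ‖U^{k+1} − U^k‖_F, ‖s^{k+1} − s^k‖₂ and ‖w^{k+1} − w^k‖₂ all converge to 0 as k → ∞. -/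
open Matrix Finset Filter Topology

noncomputable section

/-- Squared Frobenius norm of a real matrix. -/
def frobSq {a b : ℕ} (A : Matrix (Fin a) (Fin b) ℝ) : ℝ := ∑ i, ∑ j, (A i j) ^ 2

/-- Frobenius norm of a real matrix. -/
def frobNorm {a b : ℕ} (A : Matrix (Fin a) (Fin b) ℝ) : ℝ := Real.sqrt (frobSq A)

/-- Frobenius (trace) inner product of matrices. -/
def frobInner {a b : ℕ} (A B : Matrix (Fin a) (Fin b) ℝ) : ℝ := ∑ i, ∑ j, A i j * B i j

/-- Squared Euclidean norm of a vector. -/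
def vecSq {a : ℕ} (x : Fin a → ℝ) : ℝ := ∑ i, (x i) ^ 2

/-- Euclidean norm of a vector. -/
def vecNorm {a : ℕ} (x : Fin a → ℝ) : ℝ := Real.sqrt (vecSq x)

/-- Entrywise (Hadamard) product of matrices. -/
def hprod {a b : ℕ} (A B : Matrix (Fin a) (Fin b) ℝ) : Matrix (Fin a) (Fin b) ℝ :=
  Matrix.of fun i j => A i j * B i j

/-- The iALS loss L(V,U). -/
def iALSLoss {m n d : ℕ} (R : Matrix (Fin m) (Fin n) ℝ) (α₀ : ℝ)
    (lamU : Fin m → ℝ) (lamV : Fin n → ℝ)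
    (V : Matrix (Fin n) (Fin d) ℝ) (U : Matrix (Fin m) (Fin d) ℝ) : ℝ :=
  (1/2) * frobSq (hprod R (R - U * Vᵀ)) + (α₀/2) * frobSq (U * Vᵀ)
    + (1/2) * ∑ i, lamU i * vecSq (U i) + (1/2) * ∑ j, lamV j * vecSq (V j)

/-- g(V,U,s) = L(V,U) + (λ_ex/2)‖V s‖₂². -/
def gFun {m n d : ℕ} (R : Matrix (Fin m) (Fin n) ℝ) (α₀ lamex : ℝ)
    (lamU : Fin m → ℝ) (lamV : Fin n → ℝ)
    (V : Matrix (Fin n) (Fin d) ℝ) (U : Matrix (Fin m) (Fin d) ℝ) (s : Fin d → ℝ) : ℝ :=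
  iALSLoss R α₀ lamU lamV V U + (lamex/2) * vecSq (V.mulVec s)

/-- (1/m) Uᵀ 𝟙 : the average of the rows of U. -/
def avgRow {m d : ℕ} (U : Matrix (Fin m) (Fin d) ℝ) : Fin d → ℝ :=
  fun k => (1 / (m : ℝ)) * ∑ i, U i k

/-- The augmented Lagrangian L_ρ(V,U,s,w). -/
def augL {m n d : ℕ} (R : Matrix (Fin m) (Fin n) ℝ) (α₀ lamex : ℝ)
    (lamU : Fin m → ℝ) (lamV : Fin n → ℝ) (ρ : ℝ)
    (V : Matrix (Fin n) (Fin d) ℝ) (U : Matrix (Fin m) (Fin d) ℝ) (s w : Fin d → ℝ) : ℝ :=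
  gFun R α₀ lamex lamU lamV V U s + (ρ/2) * vecSq (avgRow U - s + w) - (ρ/2) * vecSq w

/-- Gradient of g with respect to V; the j-th row is
(Σ_i R_{ij} u_i u_iᵀ + α₀ UᵀU + λ_ex s sᵀ + λ_V^{(j)} I) v_j − Σ_i R_{ij} u_i. -/
def gradV {m n d : ℕ} (R : Matrix (Fin m) (Fin n) ℝ) (α₀ lamex : ℝ)
    (lamV : Fin n → ℝ)
    (V : Matrix (Fin n) (Fin d) ℝ) (U : Matrix (Fin m) (Fin d) ℝ) (s : Fin d → ℝ) :
    Matrix (Fin n) (Fin d) ℝ :=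
  Matrix.of fun j =>
    ((∑ i, R i j • vecMulVec (U i) (U i)) + α₀ • (Uᵀ * U)
        + lamex • vecMulVec s s + (lamV j) • (1 : Matrix (Fin d) (Fin d) ℝ)).mulVec (V j)
      - ∑ i, R i j • U i

/-- Gradient of g with respect to U; the i-th row is
(Σ_j R_{ij} v_j v_jᵀ + α₀ VᵀV + λ_U^{(i)} I) u_i − Σ_j R_{ij} v_j (independent of s). -/
def gradU {m n d : ℕ} (R : Matrix (Fin m) (Fin n) ℝ) (α₀ : ℝ)
    (lamU : Fin m → ℝ)
    (V : Matrix (Fin n) (Fin d) ℝ) (U : Matrix (Fin m) (Fin d) ℝ) :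
    Matrix (Fin m) (Fin d) ℝ :=
  Matrix.of fun i =>
    ((∑ j, R i j • vecMulVec (V j) (V j)) + α₀ • (Vᵀ * V)
        + (lamU i) • (1 : Matrix (Fin d) (Fin d) ℝ)).mulVec (U i)
      - ∑ j, R i j • V j

/-- Gradient of g with respect to s: λ_ex VᵀV s (independent of U). -/
def gradS {n d : ℕ} (lamex : ℝ) (V : Matrix (Fin n) (Fin d) ℝ) (s : Fin d → ℝ) : Fin d → ℝ :=
  lamex • (Vᵀ * V).mulVec s

/-- Gradient of the augmented Lagrangian with respect to U. -/
def gradUL {m n d : ℕ} (R : Matrix (Fin m) (Fin n) ℝ) (α₀ : ℝ) (lamU : Fin m → ℝ) (ρ : ℝ)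
    (V : Matrix (Fin n) (Fin d) ℝ) (U : Matrix (Fin m) (Fin d) ℝ) (s w : Fin d → ℝ) :
    Matrix (Fin m) (Fin d) ℝ :=
  Matrix.of fun i => gradU R α₀ lamU V U i + (ρ / (m : ℝ)) • (avgRow U - s + w)

/-- Gradient of the augmented Lagrangian with respect to s:
λ_ex VᵀV s − ρ((1/m)Uᵀ𝟙 − s + w). -/
def gradSL {m n d : ℕ} (lamex ρ : ℝ)
    (V : Matrix (Fin n) (Fin d) ℝ) (U : Matrix (Fin m) (Fin d) ℝ) (s w : Fin d → ℝ) :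
    Fin d → ℝ :=
  gradS lamex V s - ρ • (avgRow U - s + w)

/-- Gradient of the augmented Lagrangian with respect to w: ρ((1/m)Uᵀ𝟙 − s). -/
def gradWL {m d : ℕ} (ρ : ℝ) (U : Matrix (Fin m) (Fin d) ℝ) (s : Fin d → ℝ) : Fin d → ℝ :=
  ρ • (avgRow U - s)

/-! ### Elementary facts about the Frobenius and Euclidean norms -/

theorem vecSq_nonneg {a : ℕ} (x : Fin a → ℝ) : 0 ≤ vecSq x :=
  Finset.sum_nonneg fun _ _ => sq_nonneg _

theorem frobSq_nonneg {a b : ℕ} (A : Matrix (Fin a) (Fin b) ℝ) : 0 ≤ frobSq A :=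
  Finset.sum_nonneg fun _ _ => Finset.sum_nonneg fun _ _ => sq_nonneg _

theorem frobSq_eq_sum_vecSq {a b : ℕ} (A : Matrix (Fin a) (Fin b) ℝ) :
    frobSq A = ∑ i, vecSq (A i) := rfl

theorem vecSq_add_smul {a : ℕ} (x y : Fin a → ℝ) (t : ℝ) :
    vecSq (x + t • y) = vecSq x + t * (2 * (x ⬝ᵥ y)) + t ^ 2 * vecSq y := by
  simp only [vecSq, dotProduct, Finset.mul_sum, ← Finset.sum_add_distrib]
  refine Finset.sum_congr rfl fun i _ => ?_
  simp only [Pi.add_apply, Pi.smul_apply, smul_eq_mul]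
  ring

theorem frobSq_add_smul {a b : ℕ} (A B : Matrix (Fin a) (Fin b) ℝ) (t : ℝ) :
    frobSq (A + t • B) = frobSq A + t * (2 * frobInner A B) + t ^ 2 * frobSq B := by
  simp only [frobSq, frobInner, Finset.mul_sum, ← Finset.sum_add_distrib]
  refine Finset.sum_congr rfl fun i _ => Finset.sum_congr rfl fun j _ => ?_
  simp only [Matrix.add_apply, Matrix.smul_apply, smul_eq_mul]
  ring

theorem sum_mul_vecSq_add_smul {a b : ℕ} (l : Fin a → ℝ) (A B : Matrix (Fin a) (Fin b) ℝ) (t : ℝ) :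
    ∑ i, l i * vecSq ((A + t • B) i) = ∑ i, l i * vecSq (A i)
      + t * (2 * ∑ i, l i * (A i ⬝ᵥ B i)) + t ^ 2 * ∑ i, l i * vecSq (B i) := by
  simp only [Finset.mul_sum, ← Finset.sum_add_distrib]
  refine Finset.sum_congr rfl fun i _ => ?_
  have h : (A + t • B) i = A i + t • B i := rfl
  rw [h, vecSq_add_smul]
  ring

theorem vecSq_neg {a : ℕ} (x : Fin a → ℝ) : vecSq (-x) = vecSq x := by
  simp [vecSq]

theorem frobSq_neg {a b : ℕ} (A : Matrix (Fin a) (Fin b) ℝ) : frobSq (-A) = frobSq A := by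
  simp [frobSq]

theorem vecSq_sub_comm {a : ℕ} (x y : Fin a → ℝ) : vecSq (x - y) = vecSq (y - x) := by
  rw [← vecSq_neg, neg_sub]

theorem frobSq_sub_comm {a b : ℕ} (A B : Matrix (Fin a) (Fin b) ℝ) :
    frobSq (A - B) = frobSq (B - A) := by
  rw [← frobSq_neg, neg_sub]

theorem vecSq_smul {a : ℕ} (c : ℝ) (x : Fin a → ℝ) : vecSq (c • x) = c ^ 2 * vecSq x := by
  simp [vecSq, Finset.mul_sum, mul_pow]

theorem vecSq_add_add_le {a : ℕ} (x y z : Fin a → ℝ) :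
    vecSq (x + y + z) ≤ 3 * (vecSq x + vecSq y + vecSq z) := by
  simp only [vecSq, Finset.mul_sum, ← Finset.sum_add_distrib]
  refine Finset.sum_le_sum fun i _ => ?_
  simp only [Pi.add_apply]
  nlinarith [sq_nonneg (x i - y i), sq_nonneg (x i - z i), sq_nonneg (y i - z i)]

theorem frobSq_transpose {a b : ℕ} (A : Matrix (Fin a) (Fin b) ℝ) : frobSq Aᵀ = frobSq A :=
  Finset.sum_comm

theorem vecSq_mulVec_le {a b : ℕ} (A : Matrix (Fin a) (Fin b) ℝ) (x : Fin b → ℝ) :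
    vecSq (A *ᵥ x) ≤ frobSq A * vecSq x := by
  rw [frobSq_eq_sum_vecSq, Finset.sum_mul]
  exact Finset.sum_le_sum fun i _ => Finset.sum_mul_sq_le_sq_mul_sq Finset.univ (A i) x

theorem frobSq_mul_transpose_le {a b c : ℕ} (A : Matrix (Fin a) (Fin c) ℝ)
    (B : Matrix (Fin b) (Fin c) ℝ) : frobSq (A * Bᵀ) ≤ frobSq A * frobSq B := by
  rw [frobSq_eq_sum_vecSq A, frobSq_eq_sum_vecSq B, Finset.sum_mul_sum]
  exact Finset.sum_le_sum fun i _ => Finset.sum_le_sum fun j _ =>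
    Finset.sum_mul_sq_le_sq_mul_sq Finset.univ (A i) (B j)

theorem frobSq_hprod_le {a b : ℕ} {R : Matrix (Fin a) (Fin b) ℝ}
    (hR : ∀ i j, R i j = 0 ∨ R i j = 1) (A : Matrix (Fin a) (Fin b) ℝ) :
    frobSq (hprod R A) ≤ frobSq A := by
  refine Finset.sum_le_sum fun i _ => Finset.sum_le_sum fun j _ => ?_
  rcases hR i j with h | h <;> simp [hprod, h, sq_nonneg]

theorem hprod_sub_add_smul {a b : ℕ} (R A B : Matrix (Fin a) (Fin b) ℝ) (t : ℝ) :
    hprod R (R - (A + t • B)) = hprod R (R - A) + t • (-hprod R B) := by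
  ext i j
  simp [hprod]
  ring

theorem vecSq_transpose_mul_mulVec_le {a b : ℕ} (A B : Matrix (Fin a) (Fin b) ℝ) (x : Fin b → ℝ) :
    vecSq ((Aᵀ * B) *ᵥ x) ≤ frobSq A * (frobSq B * vecSq x) := by
  rw [← Matrix.mulVec_mulVec]
  calc vecSq (Aᵀ *ᵥ (B *ᵥ x)) ≤ frobSq Aᵀ * vecSq (B *ᵥ x) := vecSq_mulVec_le _ _
    _ ≤ frobSq A * (frobSq B * vecSq x) := by
      rw [frobSq_transpose]
      exact mul_le_mul_of_nonneg_left (vecSq_mulVec_le _ _) (frobSq_nonneg _)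

/-! ### Real quadratics and descent sequences -/

theorem linear_coeff_eq_zero_of_min {f : ℝ → ℝ} {a b c : ℝ}
    (hf : ∀ t, f t = a + t * b + t ^ 2 * c) (h : ∀ t, a ≤ f t) : b = 0 := by
  have h1 : ∀ t : ℝ, 0 ≤ c * (t * t) + b * t + 0 := fun t => by linarith [h t, hf t]
  have h2 := discrim_le_zero h1
  simp only [discrim] at h2
  nlinarith [sq_nonneg b]

/-- A sequence bounded below that decreases by at least `e k ≥ 0` at every step converges, and
`e` tends to zero. -/
theorem tendsto_of_sufficient_decrease {f e : ℕ → ℝ} {B : ℝ} (hB : ∀ k, B ≤ f k)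
    (he : ∀ k, 0 ≤ e k) (hf : ∀ k, f (k + 1) ≤ f k - e k) :
    (∃ c, Tendsto f atTop (𝓝 c)) ∧ Tendsto e atTop (𝓝 0) := by
  have hanti : Antitone f := antitone_nat_of_succ_le fun k => by linarith [hf k, he k]
  have hlim : Tendsto f atTop (𝓝 (⨅ k, f k)) :=
    tendsto_atTop_ciInf hanti ⟨B, by rintro _ ⟨k, rfl⟩; exact hB k⟩
  refine ⟨⟨_, hlim⟩, ?_⟩
  have hdiff : Tendsto (fun k => f k - f (k + 1)) atTop (𝓝 0) := by
    simpa using hlim.sub (hlim.comp (tendsto_add_atTop_nat 1))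
  exact squeeze_zero he (fun k => by linarith [hf k]) hdiff

theorem tendsto_sqrt_of_mul_le {c : ℝ} (hc : 0 < c) {x e : ℕ → ℝ} (hx : ∀ k, 0 ≤ x k)
    (hxe : ∀ k, c * x k ≤ e k) (he : Tendsto e atTop (𝓝 0)) :
    Tendsto (fun k => √(x k)) atTop (𝓝 0) := by
  have h : Tendsto x atTop (𝓝 0) := by
    refine squeeze_zero hx (fun k => ?_) (by simpa using he.const_mul c⁻¹)
    rw [le_inv_mul_iff₀ hc]
    exact hxe k
  simpa using h.sqrt

/-! ### Second-order expansions of the augmented Lagrangian -/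

section Expansions

variable {m n d : ℕ} (R : Matrix (Fin m) (Fin n) ℝ) (α₀ lamex : ℝ)
  (lamU : Fin m → ℝ) (lamV : Fin n → ℝ) (ρ : ℝ)

theorem exists_augL_add_smul_V (V D : Matrix (Fin n) (Fin d) ℝ) (U : Matrix (Fin m) (Fin d) ℝ)
    (s w : Fin d → ℝ) :
    ∃ b : ℝ, ∀ t : ℝ, augL R α₀ lamex lamU lamV ρ (V + t • D) U s w
      = augL R α₀ lamex lamU lamV ρ V U s w + t * b
        + t ^ 2 * ((1/2) * frobSq (hprod R (U * Dᵀ)) + (α₀/2) * frobSq (U * Dᵀ)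
          + (1/2) * ∑ j, lamV j * vecSq (D j) + (lamex/2) * vecSq (D *ᵥ s)) := by
  refine ⟨frobInner (hprod R (R - U * Vᵀ)) (-hprod R (U * Dᵀ)) + α₀ * frobInner (U * Vᵀ) (U * Dᵀ)
    + ∑ j, lamV j * (V j ⬝ᵥ D j) + lamex * ((V *ᵥ s) ⬝ᵥ (D *ᵥ s)), fun t => ?_⟩
  have h1 : U * (V + t • D)ᵀ = U * Vᵀ + t • (U * Dᵀ) := by
    simp [Matrix.transpose_add, Matrix.mul_add]
  have h2 : (V + t • D) *ᵥ s = V *ᵥ s + t • (D *ᵥ s) := by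
    rw [Matrix.add_mulVec, Matrix.smul_mulVec]
  simp only [augL, gFun, iALSLoss]
  rw [h1, h2, hprod_sub_add_smul, frobSq_add_smul, frobSq_add_smul, sum_mul_vecSq_add_smul,
    vecSq_add_smul, frobSq_neg]
  ring

theorem augL_add_smul_s (V : Matrix (Fin n) (Fin d) ℝ) (U : Matrix (Fin m) (Fin d) ℝ)
    (s D w : Fin d → ℝ) (t : ℝ) :
    augL R α₀ lamex lamU lamV ρ V U (s + t • D) w
      = augL R α₀ lamex lamU lamV ρ V U s w + t * (gradSL lamex ρ V U s w ⬝ᵥ D)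
        + t ^ 2 * ((lamex/2) * vecSq (V *ᵥ D) + (ρ/2) * vecSq D) := by
  have h1 : V *ᵥ (s + t • D) = V *ᵥ s + t • (V *ᵥ D) := by
    rw [Matrix.mulVec_add, Matrix.mulVec_smul]
  have h2 : avgRow U - (s + t • D) + w = (avgRow U - s + w) + t • (-D) := by
    rw [smul_neg]; abel
  have h3 : ((Vᵀ * V) *ᵥ s) ⬝ᵥ D = (V *ᵥ s) ⬝ᵥ (V *ᵥ D) := by
    rw [← Matrix.mulVec_mulVec, Matrix.mulVec_transpose, ← Matrix.dotProduct_mulVec]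
  simp only [augL, gFun, gradSL, gradS]
  rw [h1, h2, vecSq_add_smul, vecSq_add_smul, vecSq_neg, sub_dotProduct, smul_dotProduct,
    smul_dotProduct, h3, dotProduct_neg, smul_eq_mul, smul_eq_mul]
  ring

theorem frobInner_gradU {R : Matrix (Fin m) (Fin n) ℝ} (hR : ∀ i j, R i j = 0 ∨ R i j = 1)
    (V : Matrix (Fin n) (Fin d) ℝ) (U D : Matrix (Fin m) (Fin d) ℝ) :
    frobInner D (gradU R α₀ lamU V U)
      = frobInner (hprod R (R - U * Vᵀ)) (-hprod R (D * Vᵀ)) + α₀ * frobInner (U * Vᵀ) (D * Vᵀ)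
        + ∑ i, lamU i * (U i ⬝ᵥ D i) := by
  have hrow : ∀ A B : Matrix (Fin m) (Fin d) ℝ,
      frobInner A B = ∑ i, A i ⬝ᵥ B i := fun _ _ => rfl
  rw [hrow]
  simp only [frobInner, Finset.mul_sum (s := Finset.univ) (a := α₀), ← Finset.sum_add_distrib]
  refine Finset.sum_congr rfl fun i _ => ?_
  have happ : ∀ (A : Matrix (Fin m) (Fin d) ℝ) (j : Fin n), (A * Vᵀ) i j = V j ⬝ᵥ A i :=
    fun A j => by rw [dotProduct_comm]; rfl
  have hgram : D i ⬝ᵥ ((Vᵀ * V) *ᵥ U i) = ∑ j, (V j ⬝ᵥ U i) * (V j ⬝ᵥ D i) := by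
    rw [← Matrix.mulVec_mulVec, Matrix.dotProduct_mulVec, Matrix.vecMul_transpose]
    exact Finset.sum_congr rfl fun j _ => mul_comm _ _
  have hobs : D i ⬝ᵥ ((∑ j, R i j • vecMulVec (V j) (V j)) *ᵥ U i)
      = ∑ j, R i j * ((V j ⬝ᵥ U i) * (V j ⬝ᵥ D i)) := by
    rw [Matrix.sum_mulVec, dotProduct_sum]
    refine Finset.sum_congr rfl fun j _ => ?_
    rw [Matrix.smul_mulVec, Matrix.vecMulVec_mulVec, dotProduct_smul, op_smul_eq_smul,
      dotProduct_smul, dotProduct_comm (D i)]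
    rfl
  have hlin : D i ⬝ᵥ (∑ j, R i j • V j) = ∑ j, R i j * (V j ⬝ᵥ D i) := by
    rw [dotProduct_sum]
    refine Finset.sum_congr rfl fun j _ => ?_
    rw [dotProduct_smul, dotProduct_comm (D i)]
    rfl
  have hgrad : gradU R α₀ lamU V U i = ((∑ j, R i j • vecMulVec (V j) (V j)) + α₀ • (Vᵀ * V)
      + (lamU i) • (1 : Matrix (Fin d) (Fin d) ℝ)) *ᵥ (U i) - ∑ j, R i j • V j := rfl
  rw [hgrad, dotProduct_sub, Matrix.add_mulVec, Matrix.add_mulVec, dotProduct_add, dotProduct_add,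
    Matrix.smul_mulVec, Matrix.smul_mulVec, Matrix.one_mulVec, dotProduct_smul, dotProduct_smul,
    hgram, hobs, hlin, dotProduct_comm (D i), smul_eq_mul, smul_eq_mul, Finset.mul_sum,
    add_sub_right_comm, add_sub_right_comm, ← Finset.sum_sub_distrib,
    ← Finset.sum_add_distrib]
  congr 1
  refine Finset.sum_congr rfl fun j _ => ?_
  simp only [hprod, Matrix.of_apply, Matrix.neg_apply, Matrix.sub_apply, happ]
  rcases hR i j with h | h <;> rw [h] <;> ring

theorem gFun_add_U {R : Matrix (Fin m) (Fin n) ℝ} (hR : ∀ i j, R i j = 0 ∨ R i j = 1)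
    (V : Matrix (Fin n) (Fin d) ℝ) (U D : Matrix (Fin m) (Fin d) ℝ) (s : Fin d → ℝ) :
    gFun R α₀ lamex lamU lamV V (U + D) s
      = gFun R α₀ lamex lamU lamV V U s + frobInner D (gradU R α₀ lamU V U)
        + ((1/2) * frobSq (hprod R (D * Vᵀ)) + (α₀/2) * frobSq (D * Vᵀ)
          + (1/2) * ∑ i, lamU i * vecSq (D i)) := by
  have h1 : (U + (1 : ℝ) • D) * Vᵀ = U * Vᵀ + (1 : ℝ) • (D * Vᵀ) := by
    simp [Matrix.add_mul]
  rw [frobInner_gradU α₀ lamU hR]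
  conv_lhs => rw [← one_smul ℝ D]
  simp only [gFun, iALSLoss]
  rw [h1, hprod_sub_add_smul, frobSq_add_smul, frobSq_add_smul, sum_mul_vecSq_add_smul, frobSq_neg]
  ring

end Expansions

/-! ### Effect of the individual block updates -/

section Updates

variable {m n d : ℕ} {R : Matrix (Fin m) (Fin n) ℝ} {α₀ lamex ρ : ℝ}
  {lamU : Fin m → ℝ} {lamV : Fin n → ℝ}

theorem augL_V_step (hα : 0 ≤ α₀) (hlamex : 0 ≤ lamex) {μ : ℝ} (hμ : ∀ j, μ ≤ lamV j)
    {V₁ : Matrix (Fin n) (Fin d) ℝ} {U : Matrix (Fin m) (Fin d) ℝ} {s w : Fin d → ℝ}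
    (hmin : ∀ V', augL R α₀ lamex lamU lamV ρ V₁ U s w ≤ augL R α₀ lamex lamU lamV ρ V' U s w)
    (V₀ : Matrix (Fin n) (Fin d) ℝ) :
    augL R α₀ lamex lamU lamV ρ V₁ U s w + μ / 2 * frobSq (V₁ - V₀)
      ≤ augL R α₀ lamex lamU lamV ρ V₀ U s w := by
  obtain ⟨b, hb⟩ := exists_augL_add_smul_V R α₀ lamex lamU lamV ρ V₁ (V₀ - V₁) U s w
  obtain rfl : b = 0 := linear_coeff_eq_zero_of_min hb fun t => hmin _
  have h1 := hb 1
  rw [one_smul, add_sub_cancel] at h1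
  have h2 : μ * frobSq (V₀ - V₁) ≤ ∑ j, lamV j * vecSq ((V₀ - V₁) j) := by
    rw [frobSq_eq_sum_vecSq, Finset.mul_sum]
    exact Finset.sum_le_sum fun j _ => mul_le_mul_of_nonneg_right (hμ j) (vecSq_nonneg _)
  have h3 := frobSq_nonneg (hprod R (U * (V₀ - V₁)ᵀ))
  have h4 := mul_nonneg hα (frobSq_nonneg (U * (V₀ - V₁)ᵀ))
  have h5 := mul_nonneg hlamex (vecSq_nonneg ((V₀ - V₁) *ᵥ s))
  rw [frobSq_sub_comm]
  linarith

theorem augL_U_step (hR : ∀ i j, R i j = 0 ∨ R i j = 1) (hα : 0 ≤ α₀) {C l γ : ℝ}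
    (hl : ∀ i, lamU i ≤ l) (hγ : (1 + α₀) * C + l + 1 ≤ 1 / γ)
    {V : Matrix (Fin n) (Fin d) ℝ} (hV : frobSq V ≤ C)
    {U₀ U₁ : Matrix (Fin m) (Fin d) ℝ} {s w : Fin d → ℝ}
    (hmin : ∀ U' : Matrix (Fin m) (Fin d) ℝ,
      frobInner (U₁ - U₀) (gradU R α₀ lamU V U₀) + (1/(2*γ)) * frobSq (U₁ - U₀)
          + (ρ/2) * vecSq (avgRow U₁ - s + w)
        ≤ frobInner (U' - U₀) (gradU R α₀ lamU V U₀) + (1/(2*γ)) * frobSq (U' - U₀)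
          + (ρ/2) * vecSq (avgRow U' - s + w)) :
    augL R α₀ lamex lamU lamV ρ V U₁ s w + 1 / 2 * frobSq (U₁ - U₀)
      ≤ augL R α₀ lamex lamU lamV ρ V U₀ s w := by
  have hg := gFun_add_U α₀ lamex lamU lamV hR V U₀ (U₁ - U₀) s
  rw [add_sub_cancel] at hg
  have h0 := hmin U₀
  have hz : frobInner (U₀ - U₀) (gradU R α₀ lamU V U₀) = 0 := by simp [frobInner]
  have hz' : frobSq (U₀ - U₀) = 0 := by simp [frobSq]
  rw [hz, hz'] at h0
  have h1 : frobSq ((U₁ - U₀) * Vᵀ) ≤ frobSq (U₁ - U₀) * C :=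
    (frobSq_mul_transpose_le _ _).trans (mul_le_mul_of_nonneg_left hV (frobSq_nonneg _))
  have h2 := frobSq_hprod_le hR ((U₁ - U₀) * Vᵀ)
  have h3 : ∑ i, lamU i * vecSq ((U₁ - U₀) i) ≤ l * frobSq (U₁ - U₀) := by
    rw [frobSq_eq_sum_vecSq, Finset.mul_sum]
    exact Finset.sum_le_sum fun i _ => mul_le_mul_of_nonneg_right (hl i) (vecSq_nonneg _)
  have h4 := mul_le_mul_of_nonneg_left h1 hα
  have h5 := mul_le_mul_of_nonneg_right hγ (frobSq_nonneg (U₁ - U₀))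
  have h6 : 1 / (2 * γ) * frobSq (U₁ - U₀) = 1 / 2 * (1 / γ * frobSq (U₁ - U₀)) := by
    rw [one_div (2 * γ), mul_inv]; ring
  simp only [augL]
  linarith

theorem gradSL_eq_zero_of_isMin {V : Matrix (Fin n) (Fin d) ℝ} {U : Matrix (Fin m) (Fin d) ℝ}
    {s w : Fin d → ℝ}
    (hmin : ∀ s', augL R α₀ lamex lamU lamV ρ V U s w ≤ augL R α₀ lamex lamU lamV ρ V U s' w) :
    gradSL lamex ρ V U s w = 0 :=
  dotProduct_eq_zero _ fun D => linear_coeff_eq_zero_of_min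
    (augL_add_smul_s R α₀ lamex lamU lamV ρ V U s D w) fun _ => hmin _

theorem augL_s_step (hlamex : 0 ≤ lamex) {V : Matrix (Fin n) (Fin d) ℝ}
    {U : Matrix (Fin m) (Fin d) ℝ} {s₁ w : Fin d → ℝ}
    (hmin : ∀ s', augL R α₀ lamex lamU lamV ρ V U s₁ w ≤ augL R α₀ lamex lamU lamV ρ V U s' w)
    (s₀ : Fin d → ℝ) :
    augL R α₀ lamex lamU lamV ρ V U s₁ w + ρ / 2 * vecSq (s₁ - s₀)
      ≤ augL R α₀ lamex lamU lamV ρ V U s₀ w := by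
  have h1 := augL_add_smul_s R α₀ lamex lamU lamV ρ V U s₁ (s₀ - s₁) w 1
  rw [one_smul, add_sub_cancel, gradSL_eq_zero_of_isMin hmin, zero_dotProduct] at h1
  have h2 := mul_nonneg hlamex (vecSq_nonneg (V *ᵥ (s₀ - s₁)))
  rw [vecSq_sub_comm]
  linarith

theorem augL_w_step (V : Matrix (Fin n) (Fin d) ℝ) (U : Matrix (Fin m) (Fin d) ℝ)
    {s w₀ w₁ : Fin d → ℝ} (hw : w₁ = w₀ + avgRow U - s) :
    augL R α₀ lamex lamU lamV ρ V U s w₁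
      = augL R α₀ lamex lamU lamV ρ V U s w₀ + ρ * vecSq (w₁ - w₀) := by
  have h : vecSq (avgRow U - s + w₁) - vecSq w₁
      = vecSq (avgRow U - s + w₀) - vecSq w₀ + 2 * vecSq (w₁ - w₀) := by
    simp only [hw, vecSq, Finset.mul_sum, ← Finset.sum_add_distrib, ← Finset.sum_sub_distrib]
    refine Finset.sum_congr rfl fun i _ => ?_
    simp only [Pi.add_apply, Pi.sub_apply]
    ring
  simp only [augL]
  linear_combination ρ / 2 * h

theorem neg_vecSq_le_augL (hα : 0 ≤ α₀) (hlamex : 0 ≤ lamex) (hρ : 0 ≤ ρ)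
    (hlamU : ∀ i, 0 ≤ lamU i) (hlamV : ∀ j, 0 ≤ lamV j)
    (V : Matrix (Fin n) (Fin d) ℝ) (U : Matrix (Fin m) (Fin d) ℝ) (s w : Fin d → ℝ) :
    -(ρ / 2 * vecSq w) ≤ augL R α₀ lamex lamU lamV ρ V U s w := by
  have h1 := frobSq_nonneg (hprod R (R - U * Vᵀ))
  have h2 := mul_nonneg hα (frobSq_nonneg (U * Vᵀ))
  have h3 : 0 ≤ ∑ i, lamU i * vecSq (U i) :=
    Finset.sum_nonneg fun i _ => mul_nonneg (hlamU i) (vecSq_nonneg _)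
  have h4 : 0 ≤ ∑ j, lamV j * vecSq (V j) :=
    Finset.sum_nonneg fun j _ => mul_nonneg (hlamV j) (vecSq_nonneg _)
  have h5 := mul_nonneg hlamex (vecSq_nonneg (V *ᵥ s))
  have h6 := mul_nonneg hρ (vecSq_nonneg (avgRow U - s + w))
  simp only [augL, gFun, iALSLoss]
  linarith

theorem smul_eq_of_gradSL_eq_zero {V : Matrix (Fin n) (Fin d) ℝ} {U : Matrix (Fin m) (Fin d) ℝ}
    {s w₀ w₁ : Fin d → ℝ} (hs : gradSL lamex ρ V U s w₀ = 0) (hw : w₁ = w₀ + avgRow U - s) :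
    ρ • w₁ = lamex • ((Vᵀ * V) *ᵥ s) := by
  have h : avgRow U - s + w₀ = w₁ := by rw [hw]; abel
  rw [gradSL, h, sub_eq_zero] at hs
  exact hs.symm

theorem vecSq_dual_sub_le {C S : ℝ} {V₀ V₁ : Matrix (Fin n) (Fin d) ℝ}
    {s₀ s₁ w₀ w₁ : Fin d → ℝ} (hV₀ : frobSq V₀ ≤ C) (hV₁ : frobSq V₁ ≤ C) (hs₀ : vecSq s₀ ≤ S)
    (hw₀ : ρ • w₀ = lamex • ((V₀ᵀ * V₀) *ᵥ s₀)) (hw₁ : ρ • w₁ = lamex • ((V₁ᵀ * V₁) *ᵥ s₁)) :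
    ρ ^ 2 * vecSq (w₁ - w₀) ≤ lamex ^ 2 *
      (3 * C ^ 2 * vecSq (s₁ - s₀) + 6 * C * S * frobSq (V₁ - V₀)) := by
  have hC : 0 ≤ C := (frobSq_nonneg _).trans hV₀
  have hdecomp : ρ • (w₁ - w₀) = lamex • ((V₁ᵀ * V₁) *ᵥ (s₁ - s₀)
      + (V₁ᵀ * (V₁ - V₀)) *ᵥ s₀ + ((V₁ - V₀)ᵀ * V₀) *ᵥ s₀) := by
    rw [smul_sub, hw₀, hw₁, ← smul_sub]
    congr 1
    rw [Matrix.mulVec_sub, Matrix.mul_sub, Matrix.transpose_sub, Matrix.sub_mul,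
      Matrix.sub_mulVec, Matrix.sub_mulVec]
    abel
  have h1 : vecSq ((V₁ᵀ * V₁) *ᵥ (s₁ - s₀)) ≤ C * (C * vecSq (s₁ - s₀)) :=
    (vecSq_transpose_mul_mulVec_le _ _ _).trans <| by
      gcongr
      exacts [mul_nonneg (frobSq_nonneg _) (vecSq_nonneg _), vecSq_nonneg _]
  have h2 : vecSq ((V₁ᵀ * (V₁ - V₀)) *ᵥ s₀) ≤ C * (frobSq (V₁ - V₀) * S) :=
    (vecSq_transpose_mul_mulVec_le _ _ _).trans <| by
      gcongr
      exacts [mul_nonneg (frobSq_nonneg _) (vecSq_nonneg _), frobSq_nonneg _]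
  have h3 : vecSq (((V₁ - V₀)ᵀ * V₀) *ᵥ s₀) ≤ frobSq (V₁ - V₀) * (C * S) :=
    (vecSq_transpose_mul_mulVec_le _ _ _).trans <| by
      gcongr
      exacts [frobSq_nonneg _, vecSq_nonneg _]
  rw [← vecSq_smul, hdecomp, vecSq_smul]
  refine mul_le_mul_of_nonneg_left ((vecSq_add_add_le _ _ _).trans ?_) (sq_nonneg _)
  linarith

end Updates

/-! ### Parameter conditions -/

theorem le_one_div_of_step_size {m : ℕ} (hm : 1 ≤ m) {K γ : ℝ} (hK : 0 ≤ K) (hγ0 : 0 < γ)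
    (hγ : γ ≤ 1 / (√m * K + 1)) : K + 1 ≤ 1 / γ := by
  have h1 : (1 : ℝ) ≤ √m := Real.one_le_sqrt.mpr (by exact_mod_cast hm)
  have h2 : √m * K + 1 ≤ 1 / γ := by
    rw [le_one_div (by positivity) hγ0]
    exact hγ
  nlinarith

theorem add_le_sq_of_half_add_sqrt_le {ρ c : ℝ} (hc : 0 ≤ c) (h : 1/2 + √(1/4 + c) ≤ ρ) :
    ρ + c ≤ ρ ^ 2 := by
  have h1 : √(1/4 + c) ≤ ρ - 1/2 := by linarith
  have h2 := Real.sq_sqrt (show 0 ≤ 1/4 + c by positivity)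
  nlinarith [pow_le_pow_left₀ (Real.sqrt_nonneg _) h1 2]


/-- convergence of the exADMM augmented Lagrangian and residuals. -/
theorem exADMM_convergence {m n d : ℕ} (hm : 1 ≤ m) (hn : 1 ≤ n) (hd : 1 ≤ d)
    (R : Matrix (Fin m) (Fin n) ℝ) (hR : ∀ i j, R i j = 0 ∨ R i j = 1)
    (α₀ lamex ρ γ : ℝ) (hα : 0 < α₀) (hlamex : 0 < lamex) (hρ0 : 0 < ρ) (hγ0 : 0 < γ)
    (lamU : Fin m → ℝ) (lamV : Fin n → ℝ)
    (hlamU : ∀ i, 0 < lamU i) (hlamV : ∀ j, 0 < lamV j)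
    (lamUbar lamVlow : ℝ)
    (hUbar : IsGreatest (Set.range lamU) lamUbar)
    (hVlow : IsLeast (Set.range lamV) lamVlow)
    (Vs : ℕ → Matrix (Fin n) (Fin d) ℝ) (Us : ℕ → Matrix (Fin m) (Fin d) ℝ)
    (ss ws : ℕ → Fin d → ℝ)
    (CV CU Cs : ℝ) (hCV : 0 < CV) (hCU : 0 < CU) (hCs : 0 < Cs)
    (hVb : ∀ k, frobSq (Vs k) ≤ CV) (hUb : ∀ k, frobSq (Us k) ≤ CU)
    (hsb : ∀ k, vecSq (ss k) ≤ Cs)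
    (hρ : ρ ≥ max (24 * lamex ^ 2 * CV * Cs / lamVlow)
        (1/2 + Real.sqrt (1/4 + 6 * lamex ^ 2 * CV ^ 2)))
    (hγ : γ ≤ 1 / (Real.sqrt m * ((1 + α₀) * CV + lamUbar) + 1))
    (hVmin : ∀ k, ∀ V' : Matrix (Fin n) (Fin d) ℝ,
      augL R α₀ lamex lamU lamV ρ (Vs (k+1)) (Us k) (ss k) (ws k)
        ≤ augL R α₀ lamex lamU lamV ρ V' (Us k) (ss k) (ws k))
    (hUmin : ∀ k, ∀ U' : Matrix (Fin m) (Fin d) ℝ,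
      frobInner (Us (k+1) - Us k) (gradU R α₀ lamU (Vs (k+1)) (Us k))
          + (1/(2*γ)) * frobSq (Us (k+1) - Us k)
          + (ρ/2) * vecSq (avgRow (Us (k+1)) - ss k + ws k)
        ≤ frobInner (U' - Us k) (gradU R α₀ lamU (Vs (k+1)) (Us k))
          + (1/(2*γ)) * frobSq (U' - Us k)
          + (ρ/2) * vecSq (avgRow U' - ss k + ws k))
    (hsmin : ∀ k, ∀ s' : Fin d → ℝ,
      augL R α₀ lamex lamU lamV ρ (Vs (k+1)) (Us (k+1)) (ss (k+1)) (ws k)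
        ≤ augL R α₀ lamex lamU lamV ρ (Vs (k+1)) (Us (k+1)) s' (ws k))
    (hw : ∀ k, ws (k+1) = ws k + avgRow (Us (k+1)) - ss (k+1)) :
    (∃ c : ℝ, Filter.Tendsto
        (fun k => augL R α₀ lamex lamU lamV ρ (Vs k) (Us k) (ss k) (ws k))
        Filter.atTop (nhds c))
    ∧ Filter.Tendsto (fun k => frobNorm (Vs (k+1) - Vs k)) Filter.atTop (nhds 0)
    ∧ Filter.Tendsto (fun k => frobNorm (Us (k+1) - Us k)) Filter.atTop (nhds 0)
    ∧ Filter.Tendsto (fun k => vecNorm (ss (k+1) - ss k)) Filter.atTop (nhds 0)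
    ∧ Filter.Tendsto (fun k => vecNorm (ws (k+1) - ws k)) Filter.atTop (nhds 0) := by
  have hlV : 0 < lamVlow := by
    obtain ⟨j, rfl⟩ := hVlow.1
    exact hlamV j
  have hlVle : ∀ j, lamVlow ≤ lamV j := fun j => hVlow.2 ⟨j, rfl⟩
  have hlUle : ∀ i, lamU i ≤ lamUbar := fun i => hUbar.2 ⟨i, rfl⟩
  have hlU : 0 < lamUbar := by
    obtain ⟨i, rfl⟩ := hUbar.1
    exact hlamU i
  have hstep : (1 + α₀) * CV + lamUbar + 1 ≤ 1 / γ :=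
    le_one_div_of_step_size hm (by positivity) hγ0 hγ
  have hρV : 24 * lamex ^ 2 * CV * Cs ≤ ρ * lamVlow :=
    (div_le_iff₀ hlV).mp ((le_max_left _ _).trans hρ)
  have hρs : ρ + 6 * lamex ^ 2 * CV ^ 2 ≤ ρ ^ 2 :=
    add_le_sq_of_half_add_sqrt_le (by positivity) ((le_max_right _ _).trans hρ)
  have hdual : ∀ k, ρ • ws (k+1) = lamex • (((Vs (k+1))ᵀ * Vs (k+1)) *ᵥ ss (k+1)) := fun k =>
    smul_eq_of_gradSL_eq_zero (gradSL_eq_zero_of_isMin (hsmin k)) (hw k)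
  have hdw : ∀ k, ρ ^ 2 * vecSq (ws (k+1+1) - ws (k+1)) ≤ lamex ^ 2 *
      (3 * CV ^ 2 * vecSq (ss (k+1+1) - ss (k+1)) + 6 * CV * Cs * frobSq (Vs (k+1+1) - Vs (k+1))) :=
    fun k => vecSq_dual_sub_le (hVb _) (hVb _) (hsb _) (hdual _) (hdual _)
  have hdw' : ∀ k, ρ * vecSq (ws (k+1+1) - ws (k+1)) ≤
      (ρ - 1) / 2 * vecSq (ss (k+1+1) - ss (k+1))
        + lamVlow / 4 * frobSq (Vs (k+1+1) - Vs (k+1)) := fun k => by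
    refine le_of_mul_le_mul_left ?_ hρ0
    have h1 := mul_le_mul_of_nonneg_right hρV (frobSq_nonneg (Vs (k+1+1) - Vs (k+1)))
    have h2 := mul_le_mul_of_nonneg_right hρs (vecSq_nonneg (ss (k+1+1) - ss (k+1)))
    linarith [hdw k]
  let f : ℕ → ℝ := fun k => augL R α₀ lamex lamU lamV ρ (Vs k) (Us k) (ss k) (ws k)
  let e : ℕ → ℝ := fun k => lamVlow / 4 * frobSq (Vs (k+1) - Vs k)
    + 1 / 2 * frobSq (Us (k+1) - Us k) + 1 / 2 * vecSq (ss (k+1) - ss k)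
  have hV0 : ∀ k, 0 ≤ frobSq (Vs (k+1) - Vs k) := fun _ => frobSq_nonneg _
  have hU0 : ∀ k, 0 ≤ frobSq (Us (k+1) - Us k) := fun _ => frobSq_nonneg _
  have hs0 : ∀ k, 0 ≤ vecSq (ss (k+1) - ss k) := fun _ => vecSq_nonneg _
  have he : ∀ k, 0 ≤ e k := fun k => by
    simp only [e]
    linarith [mul_nonneg hlV.le (hV0 k), hU0 k, hs0 k]
  have hdesc : ∀ k, f (k+1+1) ≤ f (k+1) - e (k+1) := fun k => by
    have h1 := augL_V_step hα.le hlamex.le hlVle (hVmin (k+1)) (Vs (k+1))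
    have h2 := augL_U_step (lamex := lamex) (lamV := lamV) hR hα.le hlUle hstep (hVb _)
      (hUmin (k+1))
    have h3 := augL_s_step hlamex.le (hsmin (k+1)) (ss (k+1))
    have h4 := augL_w_step (R := R) (α₀ := α₀) (lamex := lamex) (ρ := ρ) (lamU := lamU)
      (lamV := lamV) (Vs (k+1+1)) (Us (k+1+1)) (hw (k+1))
    simp only [f, e]
    linarith [hdw' k]
  have hbound : ∀ k, -(lamex ^ 2 * (CV * (CV * Cs)) / (2 * ρ)) ≤ f (k+1) := fun k => by
    refine le_trans ?_ (neg_vecSq_le_augL hα.le hlamex.le hρ0.le (fun i => (hlamU i).le)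
      (fun j => (hlamV j).le) _ _ _ _)
    have h1 : ρ ^ 2 * vecSq (ws (k+1)) ≤ lamex ^ 2 * (CV * (CV * Cs)) := by
      rw [← vecSq_smul, hdual, vecSq_smul]
      refine mul_le_mul_of_nonneg_left ((vecSq_transpose_mul_mulVec_le _ _ _).trans ?_)
        (sq_nonneg _)
      have := vecSq_nonneg (ss (k+1))
      have := frobSq_nonneg (Vs (k+1))
      gcongr
      exacts [hVb _, hVb _, hsb _]
    rw [neg_le_neg_iff, le_div_iff₀ (by positivity)]
    linarith
  obtain ⟨⟨c, hc⟩, hlim⟩ := tendsto_of_sufficient_decrease (f := fun k => f (k+1))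
    (e := fun k => e (k+1)) hbound (fun k => he (k+1)) hdesc
  have hlim' : Tendsto e atTop (𝓝 0) := (tendsto_add_atTop_iff_nat 1).mp hlim
  refine ⟨⟨c, (tendsto_add_atTop_iff_nat 1).mp hc⟩, ?_, ?_, ?_, ?_⟩
  · refine tendsto_sqrt_of_mul_le (show 0 < lamVlow / 4 by positivity) hV0 (fun k => ?_) hlim'
    simp only [e]
    linarith [hU0 k, hs0 k]
  · refine tendsto_sqrt_of_mul_le (show (0 : ℝ) < 1 / 2 by norm_num) hU0 (fun k => ?_) hlim'
    simp only [e]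
    linarith [mul_nonneg hlV.le (hV0 k), hs0 k]
  · refine tendsto_sqrt_of_mul_le (show (0 : ℝ) < 1 / 2 by norm_num) hs0 (fun k => ?_) hlim'
    simp only [e]
    linarith [mul_nonneg hlV.le (hV0 k), hU0 k]
  · refine (tendsto_add_atTop_iff_nat 1).mp (tendsto_sqrt_of_mul_le hρ0
      (fun k => vecSq_nonneg (ws (k+1+1) - ws (k+1))) (fun k => ?_)
      (by simpa using hlim.const_mul (ρ + 1)))
    have h1 := mul_nonneg hρ0.le (mul_nonneg hlV.le (hV0 (k+1)))
    have h2 := mul_nonneg hρ0.le (hU0 (k+1))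
    simp only [e]
    linarith [hdw' k, hs0 (k+1), hU0 (k+1), mul_nonneg hlV.le (hV0 (k+1))]
end
end

section
/- For every U ∈ ℝ^{m×d}, s ∈ ℝ^d, and V, V' ∈ ℝ^{n×d}, the gradient of g with respect to V satisfies ‖∇_V g(V,U,s) − ∇_V g(V',U,s)‖_F ≤ √n · ((1+α₀)‖U‖_F² + λ_ex ‖s‖₂² + λ̄_V) · ‖V − V'‖_F. -/
open Matrix Finset Filter Topology

noncomputable section

theorem vecNorm_eq_norm {a : ℕ} (x : Fin a → ℝ) : vecNorm x = ‖WithLp.toLp 2 x‖ := by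
  simp [vecNorm, vecSq, EuclideanSpace.norm_eq]

theorem vecNorm_nonneg {a : ℕ} (x : Fin a → ℝ) : 0 ≤ vecNorm x :=
  Real.sqrt_nonneg _

theorem vecNorm_sq {a : ℕ} (x : Fin a → ℝ) : vecNorm x ^ 2 = vecSq x :=
  Real.sq_sqrt (vecSq_nonneg x)

theorem vecNorm_add_le {a : ℕ} (x y : Fin a → ℝ) :
    vecNorm (x + y) ≤ vecNorm x + vecNorm y := by
  simpa only [vecNorm_eq_norm, WithLp.toLp_add] using norm_add_le _ _

theorem vecNorm_smul {a : ℕ} (c : ℝ) (x : Fin a → ℝ) :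
    vecNorm (c • x) = |c| * vecNorm x := by
  simp only [vecNorm_eq_norm, WithLp.toLp_smul, norm_smul, Real.norm_eq_abs]

theorem vecNorm_sum_le {ι : Type*} {a : ℕ} (t : Finset ι) (f : ι → Fin a → ℝ) :
    vecNorm (∑ i ∈ t, f i) ≤ ∑ i ∈ t, vecNorm (f i) := by
  simpa only [vecNorm_eq_norm, WithLp.toLp_sum] using norm_sum_le _ _

theorem abs_dotProduct_le {a : ℕ} (x y : Fin a → ℝ) :
    |x ⬝ᵥ y| ≤ vecNorm x * vecNorm y := by
  have h := Finset.sum_mul_sq_le_sq_mul_sq Finset.univ x y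
  rw [vecNorm, vecNorm, ← Real.sqrt_mul (vecSq_nonneg x)]
  exact Real.abs_le_sqrt h

theorem vecNorm_vecMulVec_mulVec_le {a : ℕ} (u x : Fin a → ℝ) :
    vecNorm (vecMulVec u u *ᵥ x) ≤ vecSq u * vecNorm x := by
  have h : vecMulVec u u *ᵥ x = (u ⬝ᵥ x) • u := by
    rw [vecMulVec_mulVec, op_smul_eq_smul]
  rw [h, vecNorm_smul, ← vecNorm_sq]
  nlinarith [mul_le_mul_of_nonneg_right (abs_dotProduct_le u x) (vecNorm_nonneg u)]

theorem transpose_mul_self_eq_sum_vecMulVec {m d : ℕ} (U : Matrix (Fin m) (Fin d) ℝ) :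
    Uᵀ * U = ∑ i, vecMulVec (U i) (U i) := by
  ext k l
  simp [Matrix.mul_apply, Matrix.sum_apply, vecMulVec_apply]

theorem vecNorm_sum_smul_vecMulVec_mulVec_le {m d : ℕ} (U : Matrix (Fin m) (Fin d) ℝ)
    (c : Fin m → ℝ) (hc : ∀ i, |c i| ≤ 1) (x : Fin d → ℝ) :
    vecNorm ((∑ i, c i • vecMulVec (U i) (U i)) *ᵥ x) ≤ frobSq U * vecNorm x := by
  rw [sum_mulVec]
  refine (vecNorm_sum_le _ _).trans ?_
  change _ ≤ (∑ i, vecSq (U i)) * vecNorm x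
  rw [Finset.sum_mul]
  refine Finset.sum_le_sum fun i _ => ?_
  rw [smul_mulVec, vecNorm_smul]
  exact (mul_le_of_le_one_left (vecNorm_nonneg _) (hc i)).trans
    (vecNorm_vecMulVec_mulVec_le _ _)

theorem vecNorm_rowHessian_mulVec_le {m d : ℕ} (U : Matrix (Fin m) (Fin d) ℝ)
    (c : Fin m → ℝ) (hc : ∀ i, |c i| ≤ 1) {α μ ν : ℝ} (hα : 0 ≤ α) (hμ : 0 ≤ μ) (hν : 0 ≤ ν)
    (s x : Fin d → ℝ) :
    vecNorm (((∑ i, c i • vecMulVec (U i) (U i)) + α • (Uᵀ * U) + μ • vecMulVec s s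
        + ν • (1 : Matrix (Fin d) (Fin d) ℝ)) *ᵥ x)
      ≤ ((1 + α) * frobSq U + μ * vecSq s + ν) * vecNorm x := by
  have hU : vecNorm ((Uᵀ * U) *ᵥ x) ≤ frobSq U * vecNorm x := by
    simpa [transpose_mul_self_eq_sum_vecMulVec] using
      vecNorm_sum_smul_vecMulVec_mulVec_le U (fun _ => 1) (by simp) x
  simp only [add_mulVec, smul_mulVec, one_mulVec]
  grw [vecNorm_add_le, vecNorm_add_le, vecNorm_add_le, vecNorm_smul, vecNorm_smul, vecNorm_smul,
    abs_of_nonneg hα, abs_of_nonneg hμ, abs_of_nonneg hν, hU, vecNorm_vecMulVec_mulVec_le,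
    vecNorm_sum_smul_vecMulVec_mulVec_le U c hc]
  exact le_of_eq (by ring)

theorem frobNorm_le_mul_of_row_le {a b : ℕ} {A B : Matrix (Fin a) (Fin b) ℝ} {C : ℝ}
    (hC : 0 ≤ C) (h : ∀ i, vecNorm (A i) ≤ C * vecNorm (B i)) :
    frobNorm A ≤ C * frobNorm B := by
  have hAB : frobSq A ≤ C ^ 2 * frobSq B := by
    change ∑ i, vecSq (A i) ≤ C ^ 2 * ∑ i, vecSq (B i)
    rw [Finset.mul_sum]
    refine Finset.sum_le_sum fun i _ => ?_
    rw [← vecNorm_sq, ← vecNorm_sq, ← mul_pow]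
    exact pow_le_pow_left₀ (vecNorm_nonneg _) (h i) 2
  calc frobNorm A ≤ √(C ^ 2 * frobSq B) := Real.sqrt_le_sqrt hAB
    _ = C * frobNorm B := by rw [Real.sqrt_mul (sq_nonneg C), Real.sqrt_sq hC, frobNorm]

theorem gradV_sub_row {m n d : ℕ} (R : Matrix (Fin m) (Fin n) ℝ) (α₀ lamex : ℝ)
    (lamV : Fin n → ℝ) (U : Matrix (Fin m) (Fin d) ℝ) (s : Fin d → ℝ)
    (V V' : Matrix (Fin n) (Fin d) ℝ) (j : Fin n) :
    (gradV R α₀ lamex lamV V U s - gradV R α₀ lamex lamV V' U s) j =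
      ((∑ i, R i j • vecMulVec (U i) (U i)) + α₀ • (Uᵀ * U)
        + lamex • vecMulVec s s + (lamV j) • (1 : Matrix (Fin d) (Fin d) ℝ)) *ᵥ
          ((V - V') j) := by
  change (_ - _) - (_ - _) = _ *ᵥ (V j - V' j)
  rw [mulVec_sub, sub_sub_sub_cancel_right]

/-- Lipschitz bound for ∇_V g. -/
theorem gradV_lipschitz {m n d : ℕ} (hm : 1 ≤ m) (hn : 1 ≤ n) (hd : 1 ≤ d)
    (R : Matrix (Fin m) (Fin n) ℝ) (hR : ∀ i j, R i j = 0 ∨ R i j = 1)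
    (α₀ lamex : ℝ) (hα : 0 < α₀) (hlamex : 0 < lamex)
    (lamU : Fin m → ℝ) (lamV : Fin n → ℝ)
    (hlamU : ∀ i, 0 < lamU i) (hlamV : ∀ j, 0 < lamV j)
    (lamVbar : ℝ) (hVbar : IsGreatest (Set.range lamV) lamVbar)
    (U : Matrix (Fin m) (Fin d) ℝ) (s : Fin d → ℝ)
    (V V' : Matrix (Fin n) (Fin d) ℝ) :
    frobNorm (gradV R α₀ lamex lamV V U s - gradV R α₀ lamex lamV V' U s)
      ≤ Real.sqrt n * ((1 + α₀) * frobSq U + lamex * vecSq s + lamVbar)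
          * frobNorm (V - V') := by
  obtain ⟨⟨j₀, hj₀⟩, hmax⟩ := hVbar
  have hle : ∀ j, lamV j ≤ lamVbar := fun j => hmax ⟨j, rfl⟩
  have hbar : 0 ≤ lamVbar := hj₀ ▸ (hlamV j₀).le
  have hU : 0 ≤ frobSq U := Finset.sum_nonneg fun i _ => vecSq_nonneg (U i)
  have hs := vecSq_nonneg s
  have hC : 0 ≤ (1 + α₀) * frobSq U + lamex * vecSq s + lamVbar := by positivity
  have hroot : 1 ≤ Real.sqrt n := Real.one_le_sqrt.mpr (by exact_mod_cast hn)
  refine (frobNorm_le_mul_of_row_le hC fun j => ?_).trans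
    (mul_le_mul_of_nonneg_right (le_mul_of_one_le_left hC hroot) (Real.sqrt_nonneg _))
  rw [gradV_sub_row]
  have hRj : ∀ i, |R i j| ≤ 1 := fun i => by rcases hR i j with h | h <;> simp [h]
  refine (vecNorm_rowHessian_mulVec_le U _ hRj hα.le hlamex.le (hlamV j).le s _).trans ?_
  have := hle j
  exact mul_le_mul_of_nonneg_right (by linarith) (vecNorm_nonneg _)
end
end

section
/- Let C_V, C_s > 0. Suppose ‖V^k‖_F² ≤ C_V, ‖V^{k+1}‖_F² ≤ C_V, ‖s^k‖₂² ≤ C_s; suppose w^k = (1/ρ) λ_ex (V^k)ᵀV^k s^k; suppose s^{k+1} minimizes s ↦ L_ρ(V^{k+1}, U^{k+1}, s, w^k) and w^{k+1} = w^k + (1/m)(U^{k+1})ᵀ𝟙 − s^{k+1}. Then L_ρ(V^{k+1}, U^{k+1}, s^{k+1}, w^{k+1}) − L_ρ(V^{k+1}, U^{k+1}, s^{k+1}, w^k) ≤ (3 λ_ex² C_V² / ρ) ‖s^{k+1} − s^k‖₂² + (6 λ_ex² C_V C_s / ρ) ‖V^{k+1} − V^k‖_F². -/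
open Matrix Finset Filter Topology

noncomputable section

theorem vecSq_eq_dotProduct {a : ℕ} (x : Fin a → ℝ) : vecSq x = x ⬝ᵥ x := by
  simp [vecSq, dotProduct, sq]

theorem vecSq_mulVec_mulVec_le {a b c : ℕ} (A : Matrix (Fin a) (Fin b) ℝ)
    (B : Matrix (Fin b) (Fin c) ℝ) (x : Fin c → ℝ) :
    vecSq (A *ᵥ B *ᵥ x) ≤ frobSq A * frobSq B * vecSq x :=
  (vecSq_mulVec_le A _).trans <| by
    rw [mul_assoc]
    exact mul_le_mul_of_nonneg_left (vecSq_mulVec_le B x) (frobSq_nonneg A)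

/-- `(V, s) ↦ VᵀV s` is Lipschitz on bounded sets. -/
theorem vecSq_gram_mulVec_sub_le {n d : ℕ} {CV Cs : ℝ} (V W : Matrix (Fin n) (Fin d) ℝ)
    (s t : Fin d → ℝ) (hV : frobSq V ≤ CV) (hW : frobSq W ≤ CV) (ht : vecSq t ≤ Cs) :
    vecSq ((Vᵀ * V) *ᵥ s - (Wᵀ * W) *ᵥ t)
      ≤ 3 * CV ^ 2 * vecSq (s - t) + 6 * CV * Cs * frobSq (V - W) := by
  have hsplit : (Vᵀ * V) *ᵥ s - (Wᵀ * W) *ᵥ t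
      = Vᵀ *ᵥ V *ᵥ (s - t) + Vᵀ *ᵥ (V - W) *ᵥ t + (V - W)ᵀ *ᵥ W *ᵥ t := by
    simp only [mulVec_mulVec, mulVec_sub, transpose_sub, Matrix.sub_mul,
      sub_mulVec]
    abel
  have hCV : 0 ≤ CV := (frobSq_nonneg V).trans hV
  have h₁ : vecSq (Vᵀ *ᵥ V *ᵥ (s - t)) ≤ CV * CV * vecSq (s - t) := by
    refine (vecSq_mulVec_mulVec_le _ _ _).trans ?_
    rw [frobSq_transpose]
    have := frobSq_nonneg V
    have := vecSq_nonneg (s - t)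
    gcongr
  have h₂ : vecSq (Vᵀ *ᵥ (V - W) *ᵥ t) ≤ CV * frobSq (V - W) * Cs := by
    refine (vecSq_mulVec_mulVec_le _ _ _).trans ?_
    rw [frobSq_transpose]
    have := vecSq_nonneg t
    have := frobSq_nonneg (V - W)
    gcongr
  have h₃ : vecSq ((V - W)ᵀ *ᵥ W *ᵥ t) ≤ frobSq (V - W) * CV * Cs := by
    refine (vecSq_mulVec_mulVec_le _ _ _).trans ?_
    rw [frobSq_transpose]
    have := vecSq_nonneg t
    have := frobSq_nonneg (V - W)
    gcongr
  rw [hsplit]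
  refine (vecSq_add_add_le _ _ _).trans ?_
  linarith

/-- Second-order expansion of the augmented Lagrangian in `s`. -/
theorem augL_add_smul {m n d : ℕ} (R : Matrix (Fin m) (Fin n) ℝ) (α₀ lamex : ℝ)
    (lamU : Fin m → ℝ) (lamV : Fin n → ℝ) (ρ : ℝ)
    (V : Matrix (Fin n) (Fin d) ℝ) (U : Matrix (Fin m) (Fin d) ℝ) (s w e : Fin d → ℝ) (t : ℝ) :
    augL R α₀ lamex lamU lamV ρ V U (s + t • e) w
      = augL R α₀ lamex lamU lamV ρ V U s w + t * (gradSL lamex ρ V U s w ⬝ᵥ e)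
        + t ^ 2 * (lamex / 2 * vecSq (V *ᵥ e) + ρ / 2 * vecSq e) := by
  have hquad : vecSq (V *ᵥ (s + t • e))
      = vecSq (V *ᵥ s) + 2 * t * ((Vᵀ * V) *ᵥ s ⬝ᵥ e) + t ^ 2 * vecSq (V *ᵥ e) := by
    have hadj : (Vᵀ * V) *ᵥ s ⬝ᵥ e = V *ᵥ s ⬝ᵥ V *ᵥ e := by
      rw [← mulVec_mulVec, mulVec_transpose, ← dotProduct_mulVec]
    rw [hadj]
    simp only [vecSq_eq_dotProduct, mulVec_add, mulVec_smul, add_dotProduct, dotProduct_add,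
      smul_dotProduct, dotProduct_smul, smul_eq_mul, dotProduct_comm (V *ᵥ e) (V *ᵥ s)]
    ring
  have hpen : vecSq (avgRow U - (s + t • e) + w)
      = vecSq (avgRow U - s + w) - 2 * t * ((avgRow U - s + w) ⬝ᵥ e) + t ^ 2 * vecSq e := by
    rw [show avgRow U - (s + t • e) + w = (avgRow U - s + w) - t • e by abel]
    generalize avgRow U - s + w = r
    simp only [vecSq_eq_dotProduct, sub_dotProduct, dotProduct_sub,
      smul_dotProduct, dotProduct_smul, smul_eq_mul, dotProduct_comm e r]
    ring
  simp only [augL, gFun, gradSL, gradS, hquad, hpen, sub_dotProduct, smul_dotProduct, smul_eq_mul]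
  ring

/-- First-order optimality of a minimizer in `s`. -/
theorem gradSL_eq_zero_of_forall_le {m n d : ℕ} {R : Matrix (Fin m) (Fin n) ℝ} {α₀ lamex : ℝ}
    {lamU : Fin m → ℝ} {lamV : Fin n → ℝ} {ρ : ℝ}
    {V : Matrix (Fin n) (Fin d) ℝ} {U : Matrix (Fin m) (Fin d) ℝ} {s w : Fin d → ℝ}
    (hmin : ∀ s', augL R α₀ lamex lamU lamV ρ V U s w ≤ augL R α₀ lamex lamU lamV ρ V U s' w) :
    gradSL lamex ρ V U s w = 0 := by
  set h := gradSL lamex ρ V U s w with hh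
  have hdisc := discrim_le_zero (a := lamex / 2 * vecSq (V *ᵥ h) + ρ / 2 * vecSq h)
    (b := h ⬝ᵥ h) (c := 0) fun t => by
      have := hmin (s + t • h)
      rw [augL_add_smul, ← hh] at this
      linarith
  rw [discrim, mul_zero, sub_zero] at hdisc
  exact dotProduct_self_eq_zero.mp (pow_eq_zero_iff two_ne_zero |>.mp
    (le_antisymm hdisc (sq_nonneg _)))

/-- The dual update increases the augmented Lagrangian by `ρ` times the squared residual. -/
theorem augL_dual_update {m n d : ℕ} (R : Matrix (Fin m) (Fin n) ℝ) (α₀ lamex : ℝ)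
    (lamU : Fin m → ℝ) (lamV : Fin n → ℝ) (ρ : ℝ)
    (V : Matrix (Fin n) (Fin d) ℝ) (U : Matrix (Fin m) (Fin d) ℝ) (s w : Fin d → ℝ) :
    augL R α₀ lamex lamU lamV ρ V U s (w + avgRow U - s) - augL R α₀ lamex lamU lamV ρ V U s w
      = ρ * vecSq (avgRow U - s) := by
  rw [add_sub_assoc, augL, augL]
  generalize avgRow U - s = r
  simp only [vecSq_eq_dotProduct, add_dotProduct, dotProduct_add, dotProduct_comm w r]
  ring

/-- Lemma on the w update. -/
theorem w_update_increase {m n d : ℕ} (hm : 1 ≤ m) (hn : 1 ≤ n) (hd : 1 ≤ d)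
    (R : Matrix (Fin m) (Fin n) ℝ) (hR : ∀ i j, R i j = 0 ∨ R i j = 1)
    (α₀ lamex ρ : ℝ) (hα : 0 < α₀) (hlamex : 0 < lamex) (hρ0 : 0 < ρ)
    (lamU : Fin m → ℝ) (lamV : Fin n → ℝ)
    (hlamU : ∀ i, 0 < lamU i) (hlamV : ∀ j, 0 < lamV j)
    (CV Cs : ℝ) (hCV : 0 < CV) (hCs : 0 < Cs)
    (Vk Vk1 : Matrix (Fin n) (Fin d) ℝ) (Uk1 : Matrix (Fin m) (Fin d) ℝ)
    (sk sk1 wk wk1 : Fin d → ℝ)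
    (hVkb : frobSq Vk ≤ CV) (hVk1b : frobSq Vk1 ≤ CV) (hskb : vecSq sk ≤ Cs)
    (hwk : wk = (1/ρ) • gradS lamex Vk sk)
    (hsmin : ∀ s' : Fin d → ℝ,
      augL R α₀ lamex lamU lamV ρ Vk1 Uk1 sk1 wk
        ≤ augL R α₀ lamex lamU lamV ρ Vk1 Uk1 s' wk)
    (hwk1 : wk1 = wk + avgRow Uk1 - sk1) :
    augL R α₀ lamex lamU lamV ρ Vk1 Uk1 sk1 wk1
        - augL R α₀ lamex lamU lamV ρ Vk1 Uk1 sk1 wk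
      ≤ (3 * lamex ^ 2 * CV ^ 2 / ρ) * vecSq (sk1 - sk)
        + (6 * lamex ^ 2 * CV * Cs / ρ) * frobSq (Vk1 - Vk) := by
  have hgrad : gradS lamex Vk1 sk1 = ρ • (avgRow Uk1 - sk1 + wk) :=
    sub_eq_zero.mp (gradSL_eq_zero_of_forall_le hsmin)
  have hres : avgRow Uk1 - sk1
      = (lamex / ρ) • ((Vk1ᵀ * Vk1) *ᵥ sk1 - (Vkᵀ * Vk) *ᵥ sk) := by
    calc avgRow Uk1 - sk1 = (1 / ρ) • (ρ • (avgRow Uk1 - sk1 + wk)) - wk := by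
          rw [smul_smul, one_div_mul_cancel hρ0.ne', one_smul, add_sub_cancel_right]
      _ = _ := by
          rw [← hgrad, hwk, gradS, gradS, smul_smul, smul_smul, ← smul_sub, one_div_mul_eq_div]
  rw [hwk1, augL_dual_update, hres, vecSq_smul]
  calc ρ * ((lamex / ρ) ^ 2 * vecSq ((Vk1ᵀ * Vk1) *ᵥ sk1 - (Vkᵀ * Vk) *ᵥ sk))
      = lamex ^ 2 / ρ * vecSq ((Vk1ᵀ * Vk1) *ᵥ sk1 - (Vkᵀ * Vk) *ᵥ sk) := by
        field_simp
    _ ≤ lamex ^ 2 / ρ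
        * (3 * CV ^ 2 * vecSq (sk1 - sk) + 6 * CV * Cs * frobSq (Vk1 - Vk)) := by
        gcongr
        exact vecSq_gram_mulVec_sub_le _ _ _ _ hVk1b hVkb hskb
    _ = _ := by ring
end
end

section
/- Let ρ, γ > 0, s, w ∈ ℝ^d, and Ũ ∈ ℝ^{m×d}. The function U ↦ (ρ/2)‖(1/m)Uᵀ𝟙 − s + w‖₂² + (1/(2γ))‖U − Ũ‖_F² over ℝ^{m×d} has a unique minimizer, given in closed form by (I − (1/(m²(1/m + 1/(ργ)))) 𝟙𝟙ᵀ)(Ũ + (ργ/m) 𝟙(s − w)ᵀ), where I is the m×m identity matrix. -/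
open Matrix Finset Filter Topology

noncomputable section

/-- At a point where the gradient of the proximal objective vanishes, the objective expands exactly
as its value there plus a nonnegative quadratic form in the displacement. -/
theorem prox_objective_eq_of_stationary {m d : ℕ} {ρ γ : ℝ} {s w : Fin d → ℝ}
    {Ut V : Matrix (Fin m) (Fin d) ℝ}
    (hV : ∀ i k, ρ * (1 / (m : ℝ)) * (avgRow V - s + w) k + (1 / γ) * (V i k - Ut i k) = 0)
    (U : Matrix (Fin m) (Fin d) ℝ) :
    (ρ/2) * vecSq (avgRow U - s + w) + (1/(2*γ)) * frobSq (U - Ut)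
      = (ρ/2) * vecSq (avgRow V - s + w) + (1/(2*γ)) * frobSq (V - Ut)
        + ((ρ/2) * vecSq (avgRow (U - V)) + (1/(2*γ)) * frobSq (U - V)) := by
  have cross (k : Fin d) : ρ * (avgRow V - s + w) k * avgRow (U - V) k
      + (1 / γ) * ∑ i, (V i k - Ut i k) * (U i k - V i k) = 0 := by
    have h : ∑ i, (ρ * (1 / (m : ℝ)) * (avgRow V - s + w) k + (1 / γ) * (V i k - Ut i k))
        * (U i k - V i k) = 0 := Finset.sum_eq_zero fun i _ => by rw [hV, zero_mul]
    rw [← h]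
    simp only [add_mul, Finset.sum_add_distrib]
    congr 1
    · rw [← Finset.mul_sum]
      simp only [avgRow, Matrix.sub_apply]
      ring
    · simp only [Finset.mul_sum, mul_assoc]
  have column (k : Fin d) :
      (ρ/2) * ((avgRow U - s + w) k)^2 + (1/(2*γ)) * ∑ i, (U i k - Ut i k)^2
        = (ρ/2) * ((avgRow V - s + w) k)^2 + (1/(2*γ)) * ∑ i, (V i k - Ut i k)^2
          + ((ρ/2) * (avgRow (U - V) k)^2 + (1/(2*γ)) * ∑ i, (U i k - V i k)^2) := by
    have havg : (avgRow U - s + w) k = (avgRow V - s + w) k + avgRow (U - V) k := by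
      simp only [avgRow, Pi.add_apply, Pi.sub_apply, Matrix.sub_apply, Finset.sum_sub_distrib]
      ring
    have hsq : ∑ i, (U i k - Ut i k)^2 = ∑ i, (V i k - Ut i k)^2
        + 2 * ∑ i, (V i k - Ut i k) * (U i k - V i k) + ∑ i, (U i k - V i k)^2 := by
      rw [Finset.mul_sum, ← Finset.sum_add_distrib, ← Finset.sum_add_distrib]
      exact Finset.sum_congr rfl fun i _ => by ring
    rw [havg, hsq]
    have := cross k
    simp only [div_eq_mul_inv, mul_inv, one_mul] at this ⊢
    linear_combination this
  have h := Finset.sum_congr (rfl : (Finset.univ : Finset (Fin d)) = _) fun k _ => column k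
  simp only [Finset.sum_add_distrib, ← Finset.mul_sum] at h
  have swap (A B : Matrix (Fin m) (Fin d) ℝ) :
      frobSq (A - B) = ∑ k, ∑ i, (A i k - B i k)^2 := Finset.sum_comm
  simp only [swap, vecSq]
  exact h

theorem eq_zero_of_frobSq_nonpos {a b : ℕ} {A : Matrix (Fin a) (Fin b) ℝ} (h : frobSq A ≤ 0) :
    A = 0 := by
  ext i j
  have hrow := (Finset.sum_eq_zero_iff_of_nonneg
    fun i _ => Finset.sum_nonneg fun j _ => sq_nonneg (A i j)).1
    (h.antisymm (frobSq_nonneg A)) i (Finset.mem_univ i)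
  exact pow_eq_zero_iff two_ne_zero |>.1 <|
    (Finset.sum_eq_zero_iff_of_nonneg fun j _ => sq_nonneg (A i j)).1 hrow j (Finset.mem_univ j)

theorem one_sub_smul_vecMulVec_one_mul_apply {m d : ℕ} (c : ℝ) (B : Matrix (Fin m) (Fin d) ℝ)
    (i : Fin m) (k : Fin d) :
    (((1 : Matrix (Fin m) (Fin m) ℝ) - c • vecMulVec (fun _ => 1) (fun _ => 1)) * B :
      Matrix (Fin m) (Fin d) ℝ) i k
      = B i k - c * ∑ j, B j k := by
  rw [Matrix.sub_mul, Matrix.one_mul, Matrix.smul_mul]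
  simp [Matrix.mul_apply, vecMulVec_apply]

/-- closed form of the proximal mapping. -/
theorem prox_closed_form {m d : ℕ} (hm : 1 ≤ m) (hd : 1 ≤ d)
    (ρ γ : ℝ) (hρ0 : 0 < ρ) (hγ0 : 0 < γ)
    (s w : Fin d → ℝ) (Ut : Matrix (Fin m) (Fin d) ℝ) :
    let ones : Fin m → ℝ := fun _ => 1
    let f : Matrix (Fin m) (Fin d) ℝ → ℝ := fun U =>
      (ρ/2) * vecSq (avgRow U - s + w) + (1/(2*γ)) * frobSq (U - Ut)
    let Ustar : Matrix (Fin m) (Fin d) ℝ :=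
      ((1 : Matrix (Fin m) (Fin m) ℝ)
          - (1 / ((m : ℝ)^2 * (1/(m : ℝ) + 1/(ρ*γ)))) • vecMulVec ones ones)
        * (Ut + (ρ*γ/(m : ℝ)) • vecMulVec ones (s - w))
    (∀ U, f Ustar ≤ f U) ∧ ∀ U, (∀ U', f U ≤ f U') → U = Ustar := by
  intro ones f Ustar
  have hm0 : (0 : ℝ) < m := by exact_mod_cast hm
  have entry (i : Fin m) (k : Fin d) : Ustar i k = Ut i k + ρ*γ/m * (s k - w k)
      - (1 / ((m : ℝ)^2 * (1/(m : ℝ) + 1/(ρ*γ)))) * (∑ j, Ut j k + ρ*γ * (s k - w k)) := by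
    refine (one_sub_smul_vecMulVec_one_mul_apply _ _ i k).trans ?_
    simp only [ones, Matrix.add_apply, Matrix.smul_apply, vecMulVec_apply, Pi.sub_apply, smul_eq_mul,
      one_mul, Finset.sum_add_distrib, Finset.sum_const, Finset.card_univ, Fintype.card_fin,
      nsmul_eq_mul]
    congr 3
    field_simp
  have stationary (i : Fin m) (k : Fin d) :
      ρ * (1 / (m : ℝ)) * (avgRow Ustar - s + w) k + (1 / γ) * (Ustar i k - Ut i k) = 0 := by
    simp only [avgRow, Pi.add_apply, Pi.sub_apply, entry, Finset.sum_add_distrib,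
      Finset.sum_sub_distrib, Finset.sum_const, Finset.card_univ, Fintype.card_fin, nsmul_eq_mul]
    have : ρ * γ + m ≠ 0 := by positivity
    field_simp
    ring
  have expand (U) : f U = f Ustar
      + ((ρ/2) * vecSq (avgRow (U - Ustar)) + (1/(2*γ)) * frobSq (U - Ustar)) :=
    prox_objective_eq_of_stationary stationary U
  have hγ : 0 < 1/(2*γ) := by positivity
  have avg_nonneg (U) : 0 ≤ (ρ/2) * vecSq (avgRow (U - Ustar)) :=
    mul_nonneg (by positivity) (vecSq_nonneg _)
  refine ⟨fun U => ?_, fun U hU => ?_⟩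
  · have := mul_nonneg hγ.le (frobSq_nonneg (U - Ustar))
    linarith [expand U, avg_nonneg U]
  · have : 1/(2*γ) * frobSq (U - Ustar) ≤ 0 := by linarith [expand U, avg_nonneg U, hU Ustar]
    exact sub_eq_zero.1 (eq_zero_of_frobSq_nonpos (nonpos_of_mul_nonpos_right this hγ))
end
end
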